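/- arXiv:2209.14418 — 9 statements merged into one kernel-verified Lean document; each statement's English description precedes it below -/
import Mathlib

section
/- Let E be a reflexive Banach space and let Ψ, Φ : E → ℝ be C¹ functionals. Assume (Ψ1) Ψ is convex, coercive (Ψ(u) → ∞ as ‖u‖ → ∞) and weakly lower semicontinuous; assume 0 is an interior point of Ã_r for each r > 0; assume Φ is weakly (sequentially) upper semicontinuous and satisfies (Φ2) and (Φ3). Then for each r > 0, Φ is bounded from above on Ã_r and its maximum is attained at a point of the boundary; that is, there exists u_r ∈ ∂Ã_r such that Φ(u_r) = max_{u ∈ Ã_r} Φ(u) = max_{u ∈ ∂Ã_r} Φ(u). -/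
open Filter Topology Set

variable {E : Type*}

/-- Weak (sequential) convergence in a normed space: `u n ⇀ u₀` iff `f (u n) → f u₀`
for every continuous linear functional `f`. -/
def WeakConv [NormedAddCommGroup E] [NormedSpace ℝ E] (u : ℕ → E) (u₀ : E) : Prop :=
  ∀ f : E →L[ℝ] ℝ, Tendsto (fun n => f (u n)) atTop (𝓝 (f u₀))

/-- A separable subspace admits a sequence of continuous functionals on the ambient space which
separates its points. -/
theorem Submodule.exists_seq_dual_separating {F : Type*} [NormedAddCommGroup F] [NormedSpace ℝ F]
    (Y : Submodule ℝ F) [TopologicalSpace.SeparableSpace Y] :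
    ∃ f : ℕ → F →L[ℝ] ℝ, ∀ z ∈ Y, (∀ n, f n z = 0) → z = 0 := by
  choose f hf1 hf2 using fun n : ℕ =>
    exists_dual_vector'' ℝ (TopologicalSpace.denseSeq Y n : F)
  refine ⟨f, fun z hz h0 => norm_le_zero_iff.1 (le_of_forall_pos_le_add fun ε hε => ?_)⟩
  obtain ⟨n, hn⟩ := (TopologicalSpace.denseRange_denseSeq Y).exists_dist_lt (⟨z, hz⟩ : Y)
    (half_pos hε)
  set d : Y := TopologicalSpace.denseSeq Y n
  have hzd : ‖(d : F) - z‖ < ε / 2 := by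
    rwa [Subtype.dist_eq, dist_comm, dist_eq_norm] at hn
  have hd : ‖(d : F)‖ ≤ ‖(d : F) - z‖ :=
    calc ‖(d : F)‖ = f n ((d : F) - z) := by
          rw [map_sub, h0, sub_zero]
          exact (hf2 n).symm
      _ ≤ ‖f n ((d : F) - z)‖ := le_abs_self _
      _ ≤ 1 * ‖(d : F) - z‖ := (f n).le_of_opNorm_le (hf1 n) _
      _ = ‖(d : F) - z‖ := one_mul _
  have := norm_le_norm_add_norm_sub' z (d : F)
  rw [norm_sub_rev] at this
  linarith

/-- In a reflexive space, every bounded sequence has a weakly convergent subsequence. -/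
theorem exists_subseq_weakConv_of_isBounded {F : Type*} [NormedAddCommGroup F] [NormedSpace ℝ F]
    (hrefl : Function.Surjective (NormedSpace.inclusionInDoubleDual ℝ F))
    (u : ℕ → F) (hu : Bornology.IsBounded (range u)) :
    ∃ (x : F) (φ : ℕ → ℕ), StrictMono φ ∧ WeakConv (u ∘ φ) x := by
  set K : Set (WeakSpace ℝ F) := closure (toWeakSpace ℝ F '' range u)
  have hK : IsCompact K := by
    refine NormedSpace.isCompact_closure_of_isBounded ℝ F _ ?_ fun y _ => ?_
    · rwa [preimage_image_eq _ (toWeakSpace ℝ F).injective]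
    · obtain ⟨x, hx⟩ := hrefl (WeakDual.toStrongDual y)
      exact ⟨toWeakSpace ℝ F x, hx⟩
  set Y : Submodule ℝ F := (Submodule.span ℝ (range u)).topologicalClosure
  have hKY : ∀ x : F, toWeakSpace ℝ F x ∈ K → x ∈ Y := by
    intro x hx
    have hsub : K ⊆ toWeakSpace ℝ F '' (Y : Set F) := by
      rw [Submodule.topologicalClosure_coe,
        Convex.toWeakSpace_closure (𝕜 := ℝ) (Submodule.span ℝ (range u)).convex]
      exact closure_mono (image_mono Submodule.subset_span)
    obtain ⟨y, hy, hyx⟩ := hsub hx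
    rwa [← (toWeakSpace ℝ F).injective hyx]
  have : TopologicalSpace.SeparableSpace Y :=
    ((countable_range u).isSeparable.span (R := ℝ)).closure.separableSpace
  obtain ⟨f, hf⟩ := Y.exists_seq_dual_separating
  have hcont : ∀ g : F →L[ℝ] ℝ, Continuous fun x : WeakSpace ℝ F => g ((toWeakSpace ℝ F).symm x) :=
    fun g => WeakBilin.eval_continuous (topDualPairing ℝ F).flip g
  have : CompactSpace K := isCompact_iff_compactSpace.1 hK
  have : TopologicalSpace.MetrizableSpace K := by
    refine Metric.PiNatEmbed.TopologicalSpace.MetrizableSpace.of_countable_separating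
      (fun n (x : K) => f n ((toWeakSpace ℝ F).symm x))
      (fun n => (hcont (f n)).comp continuous_subtype_val) fun x y hxy => ?_
    contrapose! hxy
    refine Subtype.ext ((toWeakSpace ℝ F).symm.injective (sub_eq_zero.1 (hf _ ?_ fun n => ?_)))
    · exact Y.sub_mem (hKY _ (by simp)) (hKY _ (by simp))
    · rw [map_sub, hxy n, sub_self]
  let v : ℕ → K := fun n => ⟨toWeakSpace ℝ F (u n), subset_closure ⟨u n, mem_range_self n, rfl⟩⟩
  obtain ⟨x, φ, hφ, hx⟩ := CompactSpace.tendsto_subseq v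
  exact ⟨(toWeakSpace ℝ F).symm x, φ, hφ, fun g =>
    (((hcont g).comp continuous_subtype_val).tendsto x).comp hx⟩

/-- Proposition 1.1: under (Ψ1), `0 ∈ int Ã_r`, weak upper semicontinuity of Φ and
(Φ2)–(Φ3), for each `r > 0` the functional Φ is bounded above on `Ã_r` and attains its
maximum over `Ã_r` at a point of the boundary `∂Ã_r`. -/
theorem max_attained_on_boundary [NormedAddCommGroup E] [NormedSpace ℝ E] [CompleteSpace E]
    (hrefl : Function.Surjective (NormedSpace.inclusionInDoubleDual ℝ E))
    (Ψ Φ : E → ℝ) (hΨC1 : ContDiff ℝ 1 Ψ) (hΦC1 : ContDiff ℝ 1 Φ)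
    -- (Ψ1): Ψ is convex, coercive and weakly (sequentially) lower semicontinuous
    (hΨconv : ConvexOn ℝ Set.univ Ψ)
    (hΨcoer : Tendsto Ψ (Bornology.cobounded E) atTop)
    (hΨwlsc : ∀ (u : ℕ → E) (u₀ : E), WeakConv u u₀ →
      ∀ ε > (0:ℝ), ∀ᶠ n in atTop, Ψ u₀ - ε < Ψ (u n))
    -- 0 ∈ int Ã_r for every r > 0
    (hΨ2b : ∀ r > (0:ℝ), (0:E) ∈ interior {u : E | Ψ u ≤ r})
    -- Φ is weakly (sequentially) upper semicontinuous
    (hΦwusc : ∀ (u : ℕ → E) (u₀ : E), WeakConv u u₀ →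
      ∀ ε > (0:ℝ), ∀ᶠ n in atTop, Φ (u n) < Φ u₀ + ε)
    -- (Φ2): critical points of Φ have nonpositive Φ-value
    (hΦ2 : ∀ u : E, fderiv ℝ Φ u = 0 → Φ u ≤ 0)
    -- (Φ3): there is a sequence vₙ → 0 with Φ(vₙ) > 0
    (hΦ3 : ∃ v : ℕ → E, Tendsto v atTop (𝓝 0) ∧ ∀ n, 0 < Φ (v n))
    :
    ∀ r > (0:ℝ), ∃ u_r : E, Ψ u_r = r ∧ ∀ u : E, Ψ u ≤ r → Φ u ≤ Φ u_r := by
  intro r hr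
  set A : Set E := {u | Ψ u ≤ r}
  have hAbdd : Bornology.IsBounded A := by
    have h := hΨcoer.eventually (eventually_gt_atTop r)
    rw [← Bornology.isCobounded_compl_iff]
    exact mem_of_superset h fun u (hu : r < Ψ u) => hu.not_ge
  obtain ⟨v, hv, hvpos⟩ := hΦ3
  obtain ⟨n, hn⟩ := (hv.eventually (mem_interior_iff_mem_nhds.1 (hΨ2b r hr))).exists
  obtain ⟨y, -, hy, hyA⟩ := exists_seq_tendsto_sSup
    (S := (fun u => (Φ u : EReal)) '' A) ⟨_, mem_image_of_mem _ hn⟩ (OrderTop.bddAbove _)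
  choose u huA huy using hyA
  obtain ⟨x, φ, hφ, hx⟩ := exists_subseq_weakConv_of_isBounded hrefl u
    (hAbdd.subset (range_subset_iff.2 huA))
  have hxA : Ψ x ≤ r := by
    refine le_of_forall_pos_le_add fun ε hε => ?_
    obtain ⟨k, hk⟩ := (hΨwlsc _ x hx ε hε).exists
    have : Ψ (u (φ k)) ≤ r := huA (φ k)
    simp only [Function.comp_apply] at hk
    linarith
  have hmax : ∀ w : E, Ψ w ≤ r → Φ w ≤ Φ x := by
    intro w hw
    refine le_of_forall_pos_le_add fun ε hε => ?_
    have hle : sSup ((fun u => (Φ u : EReal)) '' A) ≤ ((Φ x + ε : ℝ) : EReal) := by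
      refine le_of_tendsto (hy.comp hφ.tendsto_atTop) ?_
      filter_upwards [hΦwusc _ x hx ε hε] with k hk
      rw [Function.comp_apply, ← huy]
      exact EReal.coe_le_coe_iff.2 hk.le
    exact EReal.coe_le_coe_iff.1 (hle.trans' (le_sSup ⟨w, hw, rfl⟩))
  refine ⟨x, hxA.eq_or_lt.resolve_right fun hlt => ?_, hmax⟩
  have hloc : IsLocalMax Φ x := by
    filter_upwards [hΨC1.continuous.continuousAt.eventually_lt_const hlt] with w hw
    exact hmax w hw.le
  exact ((hvpos n).trans_le (hmax _ hn)).not_ge (hΦ2 x hloc.fderiv_eq_zero)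
end

section
/- Let E be a reflexive Banach space and let Ψ, Φ : E → ℝ be C¹ functionals. Assume (Ψ1) Ψ is convex, coercive and weakly lower semicontinuous; assume 0 is an interior point of Ã_r for each r > 0; assume Φ is weakly (sequentially) upper semicontinuous and satisfies (Φ3), and assume (Φ2'): for each r > 0 there exists c_r > 0 such that c_r Φ(u) ≤ Φ'(u)u for all u ∈ G_r. Then for each r > 0 the maximum of Φ over Ã_r is attained at a point of the boundary ∂Ã_r, i.e. there exists u_r ∈ ∂Ã_r with Φ(u_r) = max_{u ∈ Ã_r} Φ(u) = max_{u ∈ ∂Ã_r} Φ(u). -/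
open Filter Topology Set

variable {E : Type*}

/-- A separable subset of a real normed space is separated from `0` by countably many continuous
linear functionals. -/
lemma exists_countable_dual_ne_zero [NormedAddCommGroup E] [NormedSpace ℝ E] {s : Set E}
    (hs : TopologicalSpace.IsSeparable s) :
    ∃ F : Set (E →L[ℝ] ℝ), F.Countable ∧ ∀ x ∈ s, x ≠ 0 → ∃ f ∈ F, f x ≠ 0 := by
  obtain ⟨t, -, htc, hst⟩ := hs.exists_countable_dense_subset
  choose g hg1 hg2 using fun x : E => exists_dual_vector'' ℝ x
  refine ⟨g '' t, htc.image g, fun x hx hx0 => ?_⟩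
  obtain ⟨y, hy, hxy⟩ := Metric.mem_closure_iff.mp (hst hx) (‖x‖ / 2) (by positivity)
  refine ⟨g y, mem_image_of_mem g hy, fun h => ?_⟩
  rw [dist_eq_norm, norm_sub_rev] at hxy
  have h1 : ‖y‖ ≤ ‖y - x‖ := by
    calc ‖y‖ = g y (y - x) := by rw [map_sub, h, sub_zero, hg2]; rfl
      _ ≤ ‖g y (y - x)‖ := Real.le_norm_self _
      _ ≤ 1 * ‖y - x‖ := (g y).le_of_opNorm_le (hg1 y) _
      _ = ‖y - x‖ := one_mul _
  have h2 : ‖x‖ ≤ ‖y‖ + ‖y - x‖ := by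
    simpa using norm_sub_le y (y - x)
  linarith

/-- In a reflexive space every bounded sequence has a weakly convergent subsequence. -/
theorem exists_weakConv_subseq [NormedAddCommGroup E] [NormedSpace ℝ E]
    (hrefl : Function.Surjective (NormedSpace.inclusionInDoubleDual ℝ E))
    {u : ℕ → E} (hu : Bornology.IsBounded (range u)) :
    ∃ (u₀ : E) (φ : ℕ → ℕ), StrictMono φ ∧ WeakConv (u ∘ φ) u₀ := by
  let e := toWeakSpace ℝ E
  have eval_cont : ∀ f : E →L[ℝ] ℝ, Continuous fun x : WeakSpace ℝ E => f (e.symm x) := fun f =>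
    WeakBilin.eval_continuous (topDualPairing ℝ E).flip f
  let Y : Submodule ℝ E := (Submodule.span ℝ (range u)).topologicalClosure
  have hYsep : TopologicalSpace.IsSeparable (Y : Set E) := by
    rw [Submodule.topologicalClosure_coe]
    exact (countable_range u).isSeparable.span.closure
  obtain ⟨F, hFc, hF⟩ := exists_countable_dual_ne_zero hYsep
  let K : Set (WeakSpace ℝ E) := closure (e '' range u)
  have hKcomp : IsCompact K := by
    refine NormedSpace.isCompact_closure_of_isBounded ℝ E _ ?_ ?_
    · rwa [preimage_image_eq _ e.injective]
    · intro z _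
      obtain ⟨x, hx⟩ := hrefl z
      exact ⟨e x, hx⟩
  have hKY : K ⊆ e '' Y := by
    have hY : IsClosed (e '' (Y : Set E)) := by
      rw [← (Submodule.isClosed_topologicalClosure _).closure_eq,
        Y.convex.toWeakSpace_closure ℝ]
      exact isClosed_closure
    exact closure_minimal (image_mono
      (Submodule.subset_span.trans (Submodule.le_topologicalClosure _))) hY
  have : CompactSpace K := isCompact_iff_compactSpace.mp hKcomp
  have : Encodable F := hFc.toEncodable
  have : TopologicalSpace.MetrizableSpace K := by
    refine Metric.PiNatEmbed.TopologicalSpace.MetrizableSpace.of_countable_separating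
      (fun (f : F) (x : K) => f.1 (e.symm x.1))
      (fun f => (eval_cont f.1).comp continuous_subtype_val) fun x y hxy => ?_
    obtain ⟨x', hx', hxe⟩ := hKY x.2
    obtain ⟨y', hy', hye⟩ := hKY y.2
    have hne : x' - y' ≠ 0 := fun h =>
      hxy (Subtype.ext (by rw [← hxe, ← hye, sub_eq_zero.mp h]))
    obtain ⟨f, hf, hfne⟩ := hF _ (Y.sub_mem hx' hy') hne
    refine ⟨⟨f, hf⟩, fun h => hfne ?_⟩
    simp only [← hxe, ← hye, LinearEquiv.symm_apply_apply] at h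
    rw [map_sub, h, sub_self]
  obtain ⟨a, φ, hφ, ha⟩ := CompactSpace.tendsto_subseq
    fun n => (⟨e (u n), subset_closure (mem_image_of_mem e (mem_range_self n))⟩ : K)
  refine ⟨e.symm a.1, φ, hφ, fun f => ?_⟩
  exact ((eval_cont f).comp continuous_subtype_val).tendsto a |>.comp ha

/-- In a reflexive space, a weakly sequentially upper semicontinuous function attains its maximum
on every nonempty, bounded, weakly sequentially closed set. -/
theorem exists_isMaxOn_of_weakly_usc [NormedAddCommGroup E] [NormedSpace ℝ E]
    (hrefl : Function.Surjective (NormedSpace.inclusionInDoubleDual ℝ E))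
    {A : Set E} {Φ : E → ℝ} (hne : A.Nonempty) (hA : Bornology.IsBounded A)
    (hclosed : ∀ (u : ℕ → E) (u₀ : E), (∀ n, u n ∈ A) → WeakConv u u₀ → u₀ ∈ A)
    (husc : ∀ (u : ℕ → E) (u₀ : E), WeakConv u u₀ →
      ∀ ε > (0:ℝ), ∀ᶠ n in atTop, Φ (u n) < Φ u₀ + ε) :
    ∃ u ∈ A, ∀ v ∈ A, Φ v ≤ Φ u := by
  obtain ⟨m, -, hm, hmem⟩ := exists_seq_tendsto_sSup
    (hne.image fun u => (Φ u : EReal)) (OrderTop.bddAbove _)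
  choose u huA hum using hmem
  obtain ⟨u₀, φ, hφ, hw⟩ := exists_weakConv_subseq hrefl
    (hA.subset (range_subset_iff.mpr huA))
  refine ⟨u₀, hclosed _ _ (fun n => huA (φ n)) hw, fun v hv => ?_⟩
  refine le_of_forall_pos_le_add fun ε hε => ?_
  have hsup : sSup ((fun u => (Φ u : EReal)) '' A) ≤ ((Φ u₀ + ε : ℝ) : EReal) := by
    refine le_of_tendsto (hm.comp hφ.tendsto_atTop) ?_
    filter_upwards [husc _ _ hw ε hε] with n hn
    rw [Function.comp_apply, ← hum (φ n)]
    exact EReal.coe_le_coe_iff.mpr hn.le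
  exact EReal.coe_le_coe_iff.mp ((le_sSup (mem_image_of_mem _ hv)).trans hsup)


/-- Proposition 1.1 with (Φ2) replaced by (Φ2'): for each `r > 0` there is `c_r > 0`
with `c_r Φ(u) ≤ Φ'(u)u` on `G_r`.  Then the maximum of Φ over `Ã_r` is attained on the
boundary `∂Ã_r`. -/
theorem max_attained_on_boundary' [NormedAddCommGroup E] [NormedSpace ℝ E] [CompleteSpace E]
    (hrefl : Function.Surjective (NormedSpace.inclusionInDoubleDual ℝ E))
    (Ψ Φ : E → ℝ) (hΨC1 : ContDiff ℝ 1 Ψ) (hΦC1 : ContDiff ℝ 1 Φ)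
    -- (Ψ1): Ψ is convex, coercive and weakly (sequentially) lower semicontinuous
    (hΨconv : ConvexOn ℝ Set.univ Ψ)
    (hΨcoer : Tendsto Ψ (Bornology.cobounded E) atTop)
    (hΨwlsc : ∀ (u : ℕ → E) (u₀ : E), WeakConv u u₀ →
      ∀ ε > (0:ℝ), ∀ᶠ n in atTop, Ψ u₀ - ε < Ψ (u n))
    -- 0 ∈ int Ã_r for every r > 0
    (hΨ2b : ∀ r > (0:ℝ), (0:E) ∈ interior {u : E | Ψ u ≤ r})
    -- Φ is weakly (sequentially) upper semicontinuous
    (hΦwusc : ∀ (u : ℕ → E) (u₀ : E), WeakConv u u₀ →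
      ∀ ε > (0:ℝ), ∀ᶠ n in atTop, Φ (u n) < Φ u₀ + ε)
    -- (Φ2'): for each r > 0 there is c_r > 0 with c_r Φ(u) ≤ Φ'(u)u on G_r
    (hΦ2' : ∀ r > (0:ℝ), ∃ c > (0:ℝ), ∀ u : E, Ψ u ≤ r →
      (∀ v : E, Ψ v ≤ r → Φ v ≤ Φ u) → c * Φ u ≤ fderiv ℝ Φ u u)
    -- (Φ3): there is a sequence vₙ → 0 with Φ(vₙ) > 0
    (hΦ3 : ∃ v : ℕ → E, Tendsto v atTop (𝓝 0) ∧ ∀ n, 0 < Φ (v n))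
    :
    ∀ r > (0:ℝ), ∃ u_r : E, Ψ u_r = r ∧ ∀ u : E, Ψ u ≤ r → Φ u ≤ Φ u_r := by
  intro r hr
  have hbdd : Bornology.IsBounded {u : E | Ψ u ≤ r} := by
    rw [← Bornology.isCobounded_compl_iff, Bornology.isCobounded_def]
    filter_upwards [hΨcoer.eventually_gt_atTop r] with u hu
    simpa using hu
  have h0 : (0 : E) ∈ interior {u : E | Ψ u ≤ r} := hΨ2b r hr
  have hclosed : ∀ (u : ℕ → E) (u₀ : E), (∀ n, u n ∈ {u : E | Ψ u ≤ r}) → WeakConv u u₀ →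
      u₀ ∈ {u : E | Ψ u ≤ r} := by
    intro u u₀ hu hw
    change Ψ u₀ ≤ r
    refine le_of_forall_pos_le_add fun ε hε => ?_
    obtain ⟨n, hn⟩ := (hΨwlsc u u₀ hw ε hε).exists
    have hun : Ψ (u n) ≤ r := hu n
    linarith
  obtain ⟨u, hu, hmax⟩ := exists_isMaxOn_of_weakly_usc hrefl ⟨0, interior_subset h0⟩ hbdd
    hclosed hΦwusc
  refine ⟨u, ?_, hmax⟩
  by_contra hne
  have hlt : Ψ u < r := lt_of_le_of_ne hu hne
  have hpos : 0 < Φ u := by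
    obtain ⟨v, hv, hvpos⟩ := hΦ3
    obtain ⟨n, hn⟩ := (hv.eventually (mem_interior_iff_mem_nhds.mp h0)).exists
    exact (hvpos n).trans_le (hmax _ hn)
  have hloc : IsLocalMax Φ u := by
    filter_upwards [hΨC1.continuous.continuousAt.eventually_lt_const hlt] with v hv
    exact hmax _ hv.le
  obtain ⟨c, hc, hcΦ⟩ := hΦ2' r hr
  have h := hcΦ u hu hmax
  rw [hloc.fderiv_eq_zero] at h
  exact (mul_pos hc hpos).not_ge h
end

section
/- Let E be a Banach space and Ψ : E → ℝ a C¹ functional which is coercive (Ψ(u) → ∞ as ‖u‖ → ∞), satisfies Ψ(0) = 0 and Ψ(u) > 0 for all u ≠ 0, and satisfies Ψ'(u)u ≠ 0 for every u ≠ 0. Then Ψ'(u)u > 0 for all u ≠ 0. -/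
open Filter Topology Set

variable {E : Type*}

/-- Consequence (3): if Ψ is C¹, coercive, vanishes only at 0, is positive away from 0
and `Ψ'(u)u ≠ 0` for `u ≠ 0`, then `Ψ'(u)u > 0` for all `u ≠ 0`. -/
theorem fderiv_apply_pos [NormedAddCommGroup E] [NormedSpace ℝ E] [CompleteSpace E]
    (Ψ : E → ℝ) (hΨC1 : ContDiff ℝ 1 Ψ)
    (hΨcoer : Tendsto Ψ (Bornology.cobounded E) atTop)
    (hΨ0 : Ψ 0 = 0) (hΨpos : ∀ u : E, u ≠ 0 → 0 < Ψ u)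
    (hne : ∀ u : E, u ≠ 0 → fderiv ℝ Ψ u u ≠ 0) :
    ∀ u : E, u ≠ 0 → 0 < fderiv ℝ Ψ u u := by
  intro u hu
  have hd : Differentiable ℝ Ψ := hΨC1.differentiable one_ne_zero
  have hderiv : ∀ t : ℝ, HasDerivAt (fun t : ℝ => Ψ (t • u)) (fderiv ℝ Ψ (t • u) u) t := by
    intro t
    have h : HasDerivAt (fun t : ℝ => t • u) u t := by
      simpa using (hasDerivAt_id t).smul_const u
    exact (hd (t • u)).hasFDerivAt.comp_hasDerivAt t h
  have hcont : Continuous fun t : ℝ => fderiv ℝ Ψ (t • u) u :=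
    ((hΨC1.continuous_fderiv one_ne_zero).comp
      (continuous_id.smul continuous_const)).clm_apply continuous_const
  obtain ⟨c, ⟨hc0, hc1⟩, hc⟩ := exists_hasDerivAt_eq_slope (fun t : ℝ => Ψ (t • u))
    (fun t => fderiv ℝ Ψ (t • u) u) zero_lt_one
    (fun t _ => (hderiv t).continuousAt.continuousWithinAt) (fun t _ => hderiv t)
  have hcpos : 0 < fderiv ℝ Ψ (c • u) u := by
    rw [hc]
    simpa [hΨ0] using hΨpos u hu
  by_contra hneg
  obtain ⟨t, ⟨hct, -⟩, ht⟩ := intermediate_value_Icc' hc1.le hcont.continuousOn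
    (show (0 : ℝ) ∈ Icc (fderiv ℝ Ψ ((1 : ℝ) • u) u) (fderiv ℝ Ψ (c • u) u) from
      ⟨by simpa using hneg, hcpos.le⟩)
  refine hne (t • u) (smul_ne_zero (hc0.trans_le hct).ne' hu) ?_
  rw [map_smul, show fderiv ℝ Ψ (t • u) u = 0 from ht, smul_zero]
end

section
/- Let E be a Banach space and Ψ : E → ℝ a C¹ functional which is coercive and satisfies (Ψ2), (Ψ3) and (Ψ4). Then for each fixed u ≠ 0, the map r ↦ t_u(r) given by (Ψ4) is C¹ on (0,∞) and t_u'(r) = 1 / (Ψ'(t_u(r)u)u) for all r > 0. -/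
open Filter Topology Set

variable {E : Type*}

/-- Lemma (derivamos): if Ψ is C¹, coercive and satisfies (Ψ2)–(Ψ4), then for each
fixed `u ≠ 0` the map `r ↦ t_u(r)` is C¹ on `(0,∞)` with
`t_u'(r) = 1 / Ψ'(t_u(r)u)u`. -/
theorem t_u_differentiable [NormedAddCommGroup E] [NormedSpace ℝ E] [CompleteSpace E]
    (Ψ : E → ℝ) (hΨC1 : ContDiff ℝ 1 Ψ)
    (hΨcoer : Tendsto Ψ (Bornology.cobounded E) atTop)
    -- (Ψ2): Ã₀ = {0} and 0 ∈ int Ã_r for every r > 0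
    (hΨ2a : {u : E | Ψ u ≤ 0} = {0})
    (hΨ2b : ∀ r > (0:ℝ), (0:E) ∈ interior {u : E | Ψ u ≤ r})
    -- (Ψ3): Ψ'(u)u ≠ 0 on every boundary ∂Ã_r, r > 0
    (hΨ3 : ∀ r > (0:ℝ), ∀ u : E, Ψ u = r → fderiv ℝ Ψ u u ≠ 0)
    -- (Ψ4): for every u ≠ 0 and r > 0 there is a unique t > 0 with t • u ∈ ∂Ã_r
    (hΨ4 : ∀ u : E, u ≠ 0 → ∀ r > (0:ℝ), ∃! t : ℝ, 0 < t ∧ Ψ (t • u) = r)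
    :
    ∀ u : E, u ≠ 0 → ∃ T : ℝ → ℝ,
      (∀ r > (0:ℝ), 0 < T r ∧ Ψ (T r • u) = r) ∧
      (∀ r > (0:ℝ), HasDerivAt T (1 / fderiv ℝ Ψ (T r • u) u) r) ∧
      ContinuousOn (fun r : ℝ => 1 / fderiv ℝ Ψ (T r • u) u) (Set.Ioi 0) := by
  intro u hu
  have hpos : ∀ t : ℝ, 0 < t → 0 < Ψ (t • u) := by
    intro t ht
    by_contra! h
    have hmem : t • u ∈ {u : E | Ψ u ≤ 0} := h
    rw [hΨ2a, mem_singleton_iff, smul_eq_zero] at hmem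
    exact hmem.elim ht.ne' hu
  choose! T hT hTuniq using hΨ4 u hu
  have hleft : ∀ t : ℝ, 0 < t → T (Ψ (t • u)) = t := fun t ht =>
    (hTuniq _ (hpos t ht) t ⟨ht, rfl⟩).symm
  have hne : ∀ t : ℝ, 0 < t → fderiv ℝ Ψ (t • u) u ≠ 0 := by
    intro t ht h
    refine hΨ3 _ (hpos t ht) (t • u) rfl ?_
    rw [map_smul, h, smul_zero]
  have hstrict : ∀ t : ℝ, HasStrictDerivAt (fun s : ℝ => Ψ (s • u)) (fderiv ℝ Ψ (t • u) u) t := by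
    intro t
    have hline : HasStrictDerivAt (fun s : ℝ => s • u) u t := by
      simpa using (hasStrictDerivAt_id t).smul_const u
    exact (hΨC1.hasStrictFDerivAt one_ne_zero).comp_hasStrictDerivAt t hline
  have hderiv : ∀ r > (0:ℝ), HasDerivAt T (1 / fderiv ℝ Ψ (T r • u) u) r := by
    intro r hr
    obtain ⟨htpos, hval⟩ := hT r hr
    have h := ((hstrict (T r)).to_local_left_inverse (hne _ htpos)
      ((eventually_gt_nhds htpos).mono hleft)).hasDerivAt
    rwa [hval, ← one_div] at h
  refine ⟨T, hT, hderiv, ?_⟩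
  have hTcont : ContinuousOn T (Ioi 0) := fun r hr =>
    (hderiv r hr).continuousAt.continuousWithinAt
  have hfderiv : Continuous (fderiv ℝ Ψ) := hΨC1.continuous_fderiv one_ne_zero
  refine continuousOn_const.div ?_ fun r hr => hne _ (hT r hr).1
  exact (hfderiv.comp_continuousOn (hTcont.smul continuousOn_const)).clm_apply continuousOn_const
end

section
/- Let E be a Banach space and Ψ : E → ℝ a continuous coercive functional satisfying (Ψ2) and (Ψ4). Let r₀ > 0, let u⋆ ∈ ∂Ã_{r₀}, let {r_n} ⊂ (0,∞) with r_n → r₀, and let t_n > 0 be such that t_n u⋆ ∈ ∂Ã_{r_n} for every n. Then t_n → 1 as n → ∞. -/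
open Filter Topology Set

variable {E : Type*}

/-- A continuous function which is nonpositive at `0` and positive and injective on `(0, ∞)` is
strictly increasing on `[0, ∞)`. -/
theorem strictMonoOn_Ici_of_injOn_Ioi {g : ℝ → ℝ} (hg : Continuous g) (hzero : g 0 ≤ 0)
    (hpos : ∀ s, 0 < s → 0 < g s) (hinj : InjOn g (Ioi 0)) : StrictMonoOn g (Ici 0) := by
  have hinj' : InjOn g (Ici 0) := by
    intro a ha b hb hab
    rcases (mem_Ici.1 ha).eq_or_lt with rfl | ha'
    · rcases (mem_Ici.1 hb).eq_or_lt with rfl | hb'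
      · rfl
      · linarith [hpos b hb']
    · rcases (mem_Ici.1 hb).eq_or_lt with rfl | hb'
      · linarith [hpos a ha']
      · exact hinj ha' hb' hab
  intro x hx y hy hxy
  have hy' : 0 < y := (mem_Ici.1 hx).trans_lt hxy
  exact hg.continuousOn.strictMonoOn_of_injOn_Icc hy'.le (hzero.trans (hpos y hy').le)
    (hinj'.mono Icc_subset_Ici_self) ⟨hx, hxy.le⟩ ⟨hy, le_rfl⟩ hxy

/-- Claim: if Ψ is continuous, coercive and satisfies (Ψ2), (Ψ4), `Ψ(u⋆) = r₀ > 0`,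
`rₙ > 0`, `rₙ → r₀` and `tₙ > 0` with `Ψ(tₙ u⋆) = rₙ`, then `tₙ → 1`. -/
theorem t_n_tendsto_one [NormedAddCommGroup E] [NormedSpace ℝ E] [CompleteSpace E]
    (Ψ : E → ℝ) (hΨcont : Continuous Ψ)
    (hΨcoer : Tendsto Ψ (Bornology.cobounded E) atTop)
    -- (Ψ2): Ã₀ = {0} and 0 ∈ int Ã_r for every r > 0
    (hΨ2a : {u : E | Ψ u ≤ 0} = {0})
    (hΨ2b : ∀ r > (0:ℝ), (0:E) ∈ interior {u : E | Ψ u ≤ r})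
    -- (Ψ4): for every u ≠ 0 and r > 0 there is a unique t > 0 with t • u ∈ ∂Ã_r
    (hΨ4 : ∀ u : E, u ≠ 0 → ∀ r > (0:ℝ), ∃! t : ℝ, 0 < t ∧ Ψ (t • u) = r)
    (r₀ : ℝ) (hr₀ : 0 < r₀) (ustar : E) (hustar : Ψ ustar = r₀)
    (r : ℕ → ℝ) (hrpos : ∀ n, 0 < r n) (hrlim : Tendsto r atTop (𝓝 r₀))
    (t : ℕ → ℝ) (htpos : ∀ n, 0 < t n) (ht : ∀ n, Ψ (t n • ustar) = r n) :
    Tendsto t atTop (𝓝 1) := by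
  have hΨ0 : Ψ 0 ≤ 0 := by
    have h : (0 : E) ∈ {u : E | Ψ u ≤ 0} := by rw [hΨ2a]; rfl
    exact h
  have hne : ustar ≠ 0 := by
    rintro rfl
    linarith
  have hpos : ∀ s : ℝ, 0 < s → 0 < Ψ (s • ustar) := by
    intro s hs
    by_contra! h
    have hmem : s • ustar ∈ {u : E | Ψ u ≤ 0} := h
    rw [hΨ2a] at hmem
    exact smul_ne_zero hs.ne' hne hmem
  have hmono : StrictMonoOn (fun s : ℝ => Ψ (s • ustar)) (Ici 0) := by
    refine strictMonoOn_Ici_of_injOn_Ioi (by fun_prop) (by simpa using hΨ0) hpos ?_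
    intro a ha b hb hab
    exact (hΨ4 ustar hne _ (hpos b hb)).unique ⟨ha, hab⟩ ⟨hb, rfl⟩
  have hone : Ψ ((1 : ℝ) • ustar) = r₀ := by rw [one_smul, hustar]
  refine tendsto_order.2 ⟨fun a ha => ?_, fun b hb => ?_⟩
  · rcases lt_or_ge a 0 with ha0 | ha0
    · exact Eventually.of_forall fun n => ha0.trans (htpos n)
    · have h : Ψ (a • ustar) < r₀ := hone ▸ hmono ha0 (mem_Ici.2 zero_le_one) ha
      filter_upwards [hrlim.eventually_const_lt h] with n hn
      rw [← ht n] at hn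
      exact (hmono.lt_iff_lt ha0 (htpos n).le).1 hn
  · have hb0 : (0 : ℝ) ≤ b := zero_le_one.trans hb.le
    have h : r₀ < Ψ (b • ustar) := hone ▸ hmono (mem_Ici.2 zero_le_one) hb0 hb
    filter_upwards [hrlim.eventually_lt_const h] with n hn
    rw [← ht n] at hn
    exact (hmono.lt_iff_lt (htpos n).le hb0).1 hn
end

section
/- Let E be a reflexive Banach space and let J = Ψ − Φ be a functional of class (𝒥) in E. Fix r₀ > 0, let {r_n} ⊂ (0,∞) with r_n → 0, and for each n let u_n ∈ G_{r₀ + r_n}. Then, up to a subsequence, u_n converges weakly in E to some u⋆ which is a maximum energy type point of G_{r₀}; that is, u⋆ ∈ ∂Ã_{r₀}, Φ(u⋆) = max_{u ∈ Ã_{r₀}} Φ(u), and Φ'(u⋆)u⋆/Ψ'(u⋆)u⋆ = max_{u ∈ G_{r₀}} Φ'(u)u/Ψ'(u)u. -/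
open Filter Topology Set

variable {E : Type*}

/-- A bounded sequence in a reflexive real Banach space has a weakly convergent subsequence. -/
theorem exists_subseq_weakConv_of_bounded [NormedAddCommGroup E] [NormedSpace ℝ E]
    (hrefl : Function.Surjective (NormedSpace.inclusionInDoubleDual ℝ E))
    (u : ℕ → E) (R : ℝ) (hR : ∀ n, ‖u n‖ ≤ R) :
    ∃ ns : ℕ → ℕ, StrictMono ns ∧ ∃ x : E, WeakConv (u ∘ ns) x := by
  set F : Submodule ℝ E := (Submodule.span ℝ (range u)).topologicalClosure with hF
  have huF : ∀ n, u n ∈ F := fun n =>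
    Submodule.le_topologicalClosure _ (Submodule.subset_span (mem_range_self n))
  have hFsep : TopologicalSpace.IsSeparable (F : Set E) := by
    rw [hF, Submodule.topologicalClosure_coe]
    exact ((countable_range u).isSeparable.span (R := ℝ)).closure
  have : TopologicalSpace.SeparableSpace F := hFsep.separableSpace
  have mem_F : ∀ x : E, (∀ f : StrongDual ℝ E, (∀ n, f (u n) = 0) → f x = 0) → x ∈ F := by
    intro x hx
    by_contra hxF
    obtain ⟨f, c, hlt, hgt⟩ := geometric_hahn_banach_closed_point F.convex
      (Submodule.isClosed_topologicalClosure _) hxF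
    have hc : 0 < c := by simpa using hlt 0 F.zero_mem
    have hf : ∀ n, f (u n) = 0 := by
      intro n
      by_contra hne
      have := hlt ((c / f (u n)) • u n) (F.smul_mem _ (huF n))
      simp [hne] at this
    exact (hc.trans hgt).ne' (hx f hf)
  let K : Set (WeakDual ℝ (StrongDual ℝ E)) :=
    (WeakDual.toStrongDual ⁻¹' Metric.closedBall 0 R) ∩
      {φ | ∀ f : StrongDual ℝ E, (∀ n, f (u n) = 0) → φ f = 0}
  have hKcpt : IsCompact K := by
    refine (WeakDual.isCompact_closedBall (𝕜 := ℝ) 0 R).inter_right ?_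
    simp only [ofPred_forall]
    exact isClosed_iInter fun f => isClosed_iInter fun _ =>
      isClosed_eq (WeakDual.eval_continuous f) continuous_const
  have hK : ∀ φ ∈ K, ∃ x ∈ F, ∀ f : StrongDual ℝ E, φ f = f x := by
    intro φ hφ
    obtain ⟨x, hx⟩ := hrefl (WeakDual.toStrongDual φ)
    have hx' : ∀ f : StrongDual ℝ E, φ f = f x := fun f => by
      rw [← NormedSpace.dual_def ℝ E x f, hx]; rfl
    exact ⟨x, mem_F x fun f hf => (hx' f).symm.trans (hφ.2 f hf), hx'⟩
  have : CompactSpace K := isCompact_iff_compactSpace.mp hKcpt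
  choose g hgn hg using fun n : ℕ =>
    exists_dual_vector'' ℝ (TopologicalSpace.denseSeq F n : E)
  have : TopologicalSpace.MetrizableSpace K := by
    refine Metric.PiNatEmbed.TopologicalSpace.MetrizableSpace.of_countable_separating
      (fun n (φ : K) => φ.1 (g n))
      (fun n => (WeakDual.eval_continuous (g n)).comp continuous_subtype_val) ?_
    intro φ ψ hne
    obtain ⟨x, hxF, hx⟩ := hK φ φ.2
    obtain ⟨y, hyF, hy⟩ := hK ψ ψ.2
    have hxy : x ≠ y := by
      rintro rfl
      exact hne (Subtype.ext (DFunLike.ext _ _ fun f => (hx f).trans (hy f).symm))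
    have hpos : 0 < ‖x - y‖ / 3 := by
      have := norm_pos_iff.2 (sub_ne_zero.2 hxy)
      positivity
    obtain ⟨n, hn⟩ := (TopologicalSpace.denseRange_denseSeq F).exists_dist_lt
      ⟨x - y, F.sub_mem hxF hyF⟩ hpos
    set d : E := (TopologicalSpace.denseSeq F n : E)
    have hn' : ‖(x - y) - d‖ < ‖x - y‖ / 3 := by
      rw [← dist_eq_norm]; exact hn
    refine ⟨n, fun heq => ?_⟩
    have h0 : g n (x - y) = 0 := by
      rw [map_sub, ← hx, ← hy]; exact sub_eq_zero.2 heq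
    have h1 : ‖g n ((x - y) - d)‖ ≤ ‖(x - y) - d‖ := by
      simpa using (g n).le_of_opNorm_le (hgn n) ((x - y) - d)
    rw [map_sub, h0, hg n] at h1
    simp only [RCLike.ofReal_real_eq_id, id_eq, zero_sub, norm_neg, norm_norm] at h1
    have h2 : ‖x - y‖ ≤ ‖(x - y) - d‖ + ‖d‖ := by
      simpa using norm_add_le ((x - y) - d) d
    linarith
  let φ : ℕ → K := fun n =>
    ⟨StrongDual.toWeakDual (NormedSpace.inclusionInDoubleDual ℝ E (u n)), by
      have h : NormedSpace.inclusionInDoubleDual ℝ E (u n) ∈ Metric.closedBall 0 R :=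
        (mem_closedBall_zero_iff (E := StrongDual ℝ (StrongDual ℝ E))).2
          ((NormedSpace.double_dual_bound ℝ E (u n)).trans (hR n))
      exact ⟨h, fun f hf => hf n⟩⟩
  obtain ⟨ψ, ns, hns, hlim⟩ := CompactSpace.tendsto_subseq φ
  obtain ⟨x, -, hx⟩ := hK ψ ψ.2
  refine ⟨ns, hns, x, fun f => ?_⟩
  have := ((WeakDual.eval_continuous f).tendsto ψ.1).comp
    ((continuous_subtype_val.tendsto ψ).comp hlim)
  rw [hx f] at this
  exact this

/-- **Cauchy's mean value theorem** along a ray: the quotient of increments of `Φ` and `Ψ` is the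
quotient of their derivatives in the radial direction at an intermediate point. -/
theorem exists_radial_cauchy_mean_value [NormedAddCommGroup E] [NormedSpace ℝ E]
    {Ψ Φ : E → ℝ} (hΨ : Differentiable ℝ Ψ) (hΦ : Differentiable ℝ Φ) (w : E) {a b : ℝ}
    (ha : 0 < a) (hab : a < b)
    (hne : ∀ c ∈ Ioo a b, fderiv ℝ Ψ (c • w) (c • w) ≠ 0) :
    ∃ c ∈ Ioo a b, Φ (b • w) - Φ (a • w) =
      fderiv ℝ Φ (c • w) (c • w) / fderiv ℝ Ψ (c • w) (c • w) * (Ψ (b • w) - Ψ (a • w)) := by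
  have hderiv : ∀ {f : E → ℝ}, Differentiable ℝ f → ∀ t : ℝ,
      HasDerivAt (fun t : ℝ => f (t • w)) (fderiv ℝ f (t • w) w) t := fun hf t => by
    have h : HasDerivAt (fun t : ℝ => t • w) w t := by
      simpa using (hasDerivAt_id t).smul_const w
    exact (hf (t • w)).hasFDerivAt.comp_hasDerivAt t h
  obtain ⟨c, hc, h⟩ := exists_ratio_hasDerivAt_eq_ratio_slope
    (fun t : ℝ => Φ (t • w)) (fun t => fderiv ℝ Φ (t • w) w) hab
    (fun t _ => (hderiv hΦ t).continuousAt.continuousWithinAt) (fun t _ => hderiv hΦ t)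
    (fun t : ℝ => Ψ (t • w)) (fun t => fderiv ℝ Ψ (t • w) w)
    (fun t _ => (hderiv hΨ t).continuousAt.continuousWithinAt) (fun t _ => hderiv hΨ t)
  refine ⟨c, hc, ?_⟩
  have hc0 : c ≠ 0 := (ha.trans hc.1).ne'
  have hne' := hne c hc
  simp only [map_smul, smul_eq_mul] at hne' ⊢
  rw [mul_div_mul_left _ _ hc0]
  have := right_ne_zero_of_mul hne'
  field_simp
  linarith

/-- Claim 1 in Proposition (provardif): if `J = Ψ - Φ` is of class (𝒥), `r₀ > 0`,
`rₙ → 0⁺` and `uₙ ∈ G_(r₀+rₙ)`, then up to a subsequence `uₙ ⇀ u⋆` where `u⋆` is a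
maximum energy type point of `G_(r₀)`. -/
theorem weak_limit_is_max_energy_point [NormedAddCommGroup E] [NormedSpace ℝ E] [CompleteSpace E]
    (hrefl : Function.Surjective (NormedSpace.inclusionInDoubleDual ℝ E))
    (Ψ Φ : E → ℝ) (hΨC1 : ContDiff ℝ 1 Ψ) (hΦC1 : ContDiff ℝ 1 Φ)
    -- (Ψ1): Ψ is convex, coercive and weakly (sequentially) lower semicontinuous
    (hΨconv : ConvexOn ℝ Set.univ Ψ)
    (hΨcoer : Tendsto Ψ (Bornology.cobounded E) atTop)
    (hΨwlsc : ∀ (u : ℕ → E) (u₀ : E), WeakConv u u₀ →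
      ∀ ε > (0:ℝ), ∀ᶠ n in atTop, Ψ u₀ - ε < Ψ (u n))
    -- (Ψ2): Ã₀ = {0} and 0 ∈ int Ã_r for every r > 0
    (hΨ2a : {u : E | Ψ u ≤ 0} = {0})
    (hΨ2b : ∀ r > (0:ℝ), (0:E) ∈ interior {u : E | Ψ u ≤ r})
    -- (Ψ3): Ψ'(u)u ≠ 0 on every boundary ∂Ã_r, r > 0
    (hΨ3 : ∀ r > (0:ℝ), ∀ u : E, Ψ u = r → fderiv ℝ Ψ u u ≠ 0)
    -- (Ψ4): for every u ≠ 0 and r > 0 there is a unique t > 0 with t • u ∈ ∂Ã_r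
    (hΨ4 : ∀ u : E, u ≠ 0 → ∀ r > (0:ℝ), ∃! t : ℝ, 0 < t ∧ Ψ (t • u) = r)
    -- (Ψ5): weak convergence plus convergence of Ψ-values implies strong convergence
    (hΨ5 : ∀ (u : ℕ → E) (u₀ : E), WeakConv u u₀ →
      Tendsto (fun n => Ψ (u n)) atTop (𝓝 (Ψ u₀)) → Tendsto u atTop (𝓝 u₀))
    -- Φ is weakly (sequentially) upper semicontinuous
    (hΦwusc : ∀ (u : ℕ → E) (u₀ : E), WeakConv u u₀ →
      ∀ ε > (0:ℝ), ∀ᶠ n in atTop, Φ (u n) < Φ u₀ + ε)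
    -- (Φ1), second part: u ↦ Φ'(u)u/Ψ'(u)u is weakly (sequentially) upper
    -- semicontinuous on E ∖ {0}
    (hQwusc : ∀ (u : ℕ → E) (u₀ : E), u₀ ≠ 0 → (∀ n, u n ≠ 0) → WeakConv u u₀ →
      ∀ ε > (0:ℝ), ∀ᶠ n in atTop,
        fderiv ℝ Φ (u n) (u n) / fderiv ℝ Ψ (u n) (u n) <
          fderiv ℝ Φ u₀ u₀ / fderiv ℝ Ψ u₀ u₀ + ε)
    -- (Φ2): critical points of Φ have nonpositive Φ-value
    (hΦ2 : ∀ u : E, fderiv ℝ Φ u = 0 → Φ u ≤ 0)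
    -- (Φ3): there is a sequence vₙ → 0 with Φ(vₙ) > 0
    (hΦ3 : ∃ v : ℕ → E, Tendsto v atTop (𝓝 0) ∧ ∀ n, 0 < Φ (v n))
    (r₀ : ℝ) (hr₀ : 0 < r₀)
    (r : ℕ → ℝ) (hrpos : ∀ n, 0 < r n) (hrlim : Tendsto r atTop (𝓝 0))
    (u : ℕ → E)
    (hu : ∀ n, Ψ (u n) ≤ r₀ + r n ∧ ∀ v : E, Ψ v ≤ r₀ + r n → Φ v ≤ Φ (u n)) :
    ∃ ns : ℕ → ℕ, StrictMono ns ∧ ∃ ustar : E,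
      WeakConv (u ∘ ns) ustar ∧ Ψ ustar = r₀ ∧
      (∀ v : E, Ψ v ≤ r₀ → Φ v ≤ Φ ustar) ∧
      (∀ v : E, Ψ v ≤ r₀ → (∀ z : E, Ψ z ≤ r₀ → Φ z ≤ Φ v) →
        fderiv ℝ Φ v v / fderiv ℝ Ψ v v ≤
          fderiv ℝ Φ ustar ustar / fderiv ℝ Ψ ustar ustar) := by
  have hΨd : Differentiable ℝ Ψ := hΨC1.differentiable one_ne_zero
  have hΦd : Differentiable ℝ Φ := hΦC1.differentiable one_ne_zero
  have hΨ0 : Ψ 0 ≤ 0 := by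
    have : (0 : E) ∈ {u : E | Ψ u ≤ 0} := hΨ2a ▸ mem_singleton 0
    exact this
  have hΨpos : ∀ x : E, x ≠ 0 → 0 < Ψ x := by
    intro x hx
    by_contra h
    have : x ∈ {u : E | Ψ u ≤ 0} := not_lt.1 h
    rw [hΨ2a] at this
    exact hx this
  have ne_zero : ∀ x : E, 0 < Ψ x → x ≠ 0 := by
    rintro x hx rfl
    exact hx.not_ge hΨ0
  have hscale : ∀ (x : E) (s : ℝ), 0 ≤ s → s ≤ 1 → Ψ (s • x) ≤ s * Ψ x := by
    intro x s h0 h1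
    have h := hΨconv.2 (mem_univ x) (mem_univ (0 : E)) h0 (sub_nonneg.2 h1) (by ring)
    simp only [smul_zero, add_zero, smul_eq_mul] at h
    nlinarith
  have hray : ∀ x : E, Continuous fun t : ℝ => Ψ (t • x) := fun x =>
    hΨd.continuous.comp (continuous_id.smul continuous_const)
  -- constrained maximizers lie on the boundary of the sublevel set
  have hbdry : ∀ ρ > (0 : ℝ), ∀ w : E, Ψ w ≤ ρ → (∀ v, Ψ v ≤ ρ → Φ v ≤ Φ w) → Ψ w = ρ := by
    intro ρ hρ w hw hmax
    by_contra hne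
    have hlt := lt_of_le_of_ne hw hne
    have hloc : IsLocalMax Φ w := by
      filter_upwards [hΨd.continuous.continuousAt.eventually_lt_const hlt] with v hv
      exact hmax v hv.le
    obtain ⟨v, hv, hvpos⟩ := hΦ3
    obtain ⟨n, hn⟩ := (((hΨd.continuous.tendsto 0).comp hv).eventually_lt_const
      (hΨ0.trans_lt hρ)).exists
    have h1 := hmax (v n) hn.le
    have h2 := hΦ2 w hloc.fderiv_eq_zero
    linarith [hvpos n]
  have hρpos : ∀ n, 0 < r₀ + r n := fun n => add_pos hr₀ (hrpos n)
  have hΨu : ∀ n, Ψ (u n) = r₀ + r n := fun n => hbdry _ (hρpos n) _ (hu n).1 (hu n).2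
  have hΨu_lim : Tendsto (fun n => Ψ (u n)) atTop (𝓝 r₀) := by
    simp only [hΨu]
    simpa using hrlim.const_add r₀
  -- boundedness of the sequence
  obtain ⟨R, hR⟩ : ∃ R, ∀ n, ‖u n‖ ≤ R := by
    obtain ⟨B, hB⟩ := hΨu_lim.bddAbove_range
    have hbd : Bornology.IsBounded {x : E | Ψ x ≤ B} := by
      rw [← Bornology.isCobounded_compl_iff]
      filter_upwards [hΨcoer.eventually_gt_atTop B] with x hx
      exact not_le.2 hx
    obtain ⟨R, hR⟩ := hbd.exists_norm_le
    exact ⟨R, fun n => hR _ (hB (mem_range_self n))⟩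
  obtain ⟨ns, hns, w, hw⟩ := exists_subseq_weakConv_of_bounded hrefl u R hR
  have hΨlim : Tendsto (fun k => Ψ (u (ns k))) atTop (𝓝 r₀) :=
    hΨu_lim.comp hns.tendsto_atTop
  have hwle : Ψ w ≤ r₀ := by
    refine le_of_forall_pos_le_add fun ε hε => ?_
    have := ge_of_tendsto hΨlim ((hΨwlsc _ _ hw ε hε).mono fun k hk => hk.le)
    linarith
  have hwmax : ∀ v : E, Ψ v ≤ r₀ → Φ v ≤ Φ w := by
    intro v hv
    refine le_of_forall_pos_le_add fun ε hε => ?_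
    obtain ⟨k, hk⟩ := (hΦwusc _ _ hw ε hε).exists
    exact ((hu (ns k)).2 v (by linarith [hrpos (ns k)])).trans hk.le
  have hΨw : Ψ w = r₀ := hbdry r₀ hr₀ w hwle hwmax
  have hstrong : Tendsto (u ∘ ns) atTop (𝓝 w) := hΨ5 _ _ hw (hΨw ▸ hΨlim)
  refine ⟨ns, hns, w, hw, hΨw, hwmax, fun v hv hvmax => ?_⟩
  have hΨv : Ψ v = r₀ := hbdry r₀ hr₀ v hv hvmax
  let Q : E → ℝ := fun x => fderiv ℝ Φ x x / fderiv ℝ Ψ x x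
  have hQcont : ∀ x : E, x ≠ 0 → ContinuousAt Q x := fun x hx =>
    (((hΦC1.continuous_fderiv one_ne_zero).clm_apply continuous_id).continuousAt).div
      (((hΨC1.continuous_fderiv one_ne_zero).clm_apply continuous_id).continuousAt)
      (hΨ3 _ (hΨpos x hx) x rfl)
  have hcauchy : ∀ x : E, x ≠ 0 → ∀ a b : ℝ, 0 < a → a < b → ∃ c ∈ Ioo a b,
      Φ (b • x) - Φ (a • x) = Q (c • x) * (Ψ (b • x) - Ψ (a • x)) := by
    intro x hx a b ha hab
    refine exists_radial_cauchy_mean_value hΨd hΦd x ha hab fun c hc => ?_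
    exact hΨ3 _ (hΨpos _ (smul_ne_zero (ha.trans hc.1).ne' hx)) _ rfl
  set T : ℕ → ℝ := fun n => (r₀ + r n) / r₀ with hT
  have hT1 : ∀ n, 1 < T n := fun n => by
    rw [hT, one_lt_div hr₀]
    linarith [hrpos n]
  have hTlim : Tendsto T atTop (𝓝 1) := by
    have := (hrlim.const_add r₀).div_const r₀
    rwa [add_zero, div_self hr₀.ne'] at this
  have hlower : ∀ n, ∃ c ∈ Ioo 1 (T n), Q (c • v) * r n ≤ Φ (u n) - Φ v := by
    intro n
    have hTpos : 0 < T n := one_pos.trans (hT1 n)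
    have hΨT : r₀ + r n ≤ Ψ (T n • v) := by
      have h := hscale (T n • v) (T n)⁻¹ (by positivity) (inv_le_one_of_one_le₀ (hT1 n).le)
      rw [inv_smul_smul₀ hTpos.ne', hΨv, inv_mul_eq_div, le_div_iff₀ hTpos] at h
      rwa [hT, mul_div_cancel₀ _ hr₀.ne'] at h
    obtain ⟨t, ht, hΨt⟩ := intermediate_value_Icc (hT1 n).le (hray v).continuousOn
      (show r₀ + r n ∈ Icc (Ψ ((1 : ℝ) • v)) (Ψ (T n • v)) from
        ⟨by rw [one_smul]; linarith [hrpos n], hΨT⟩)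
    simp only at hΨt
    have ht1 : 1 < t := lt_of_le_of_ne ht.1 <| by
      rintro rfl
      rw [one_smul] at hΨt
      linarith [hrpos n]
    obtain ⟨c, hc, h⟩ := hcauchy v (ne_zero v (hΨv ▸ hr₀)) 1 t one_pos ht1
    rw [one_smul, hΨt, hΨv, add_sub_cancel_left] at h
    exact ⟨c, ⟨hc.1, hc.2.trans_le ht.2⟩, by linarith [(hu n).2 _ hΨt.le]⟩
  have hupper : ∀ n, ∃ c ∈ Ioo (T n)⁻¹ 1, Φ (u n) - Φ v ≤ Q (c • u n) * r n := by
    intro n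
    have hTpos : 0 < T n := one_pos.trans (hT1 n)
    have hTinv : (T n)⁻¹ ≤ 1 := inv_le_one_of_one_le₀ (hT1 n).le
    have hΨT : Ψ ((T n)⁻¹ • u n) ≤ r₀ := by
      refine (hscale (u n) _ (by positivity) hTinv).trans_eq ?_
      rw [hΨu, hT, inv_div, div_mul_cancel₀ _ (hρpos n).ne']
    obtain ⟨s, hs, hΨs⟩ := intermediate_value_Icc hTinv (hray (u n)).continuousOn
      (show r₀ ∈ Icc (Ψ ((T n)⁻¹ • u n)) (Ψ ((1 : ℝ) • u n)) from
        ⟨hΨT, by rw [one_smul, hΨu]; linarith [hrpos n]⟩)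
    simp only at hΨs
    have hs1 : s < 1 := lt_of_le_of_ne hs.2 <| by
      rintro rfl
      rw [one_smul, hΨu] at hΨs
      linarith [hrpos n]
    obtain ⟨c, hc, h⟩ := hcauchy (u n) (ne_zero _ (hΨu n ▸ hρpos n)) s 1
      ((inv_pos.2 hTpos).trans_le hs.1) hs1
    rw [one_smul, hΨs, hΨu, add_sub_cancel_left] at h
    exact ⟨c, ⟨hs.1.trans_lt hc.1, hc.2⟩, by linarith [hvmax _ hΨs.le]⟩
  choose a ha hlow using hlower
  choose b hb hup using hupper
  have halim : Tendsto a atTop (𝓝 1) := tendsto_of_tendsto_of_tendsto_of_le_of_le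
    tendsto_const_nhds hTlim (fun n => (ha n).1.le) (fun n => (ha n).2.le)
  have hblim : Tendsto b atTop (𝓝 1) := tendsto_of_tendsto_of_tendsto_of_le_of_le
    (by simpa using hTlim.inv₀ one_ne_zero) tendsto_const_nhds
    (fun n => (hb n).1.le) (fun n => (hb n).2.le)
  have hav : Tendsto (fun k => a (ns k) • v) atTop (𝓝 v) := by
    simpa using (halim.comp hns.tendsto_atTop).smul_const v
  have hbu : Tendsto (fun k => b (ns k) • u (ns k)) atTop (𝓝 w) := by
    simpa using (hblim.comp hns.tendsto_atTop).smul hstrong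
  exact le_of_tendsto_of_tendsto' ((hQcont v (ne_zero v (hΨv ▸ hr₀))).tendsto.comp hav)
    ((hQcont w (ne_zero w (hΨw ▸ hr₀))).tendsto.comp hbu)
    fun k => le_of_mul_le_mul_right ((hlow (ns k)).trans (hup (ns k))) (hrpos (ns k))
end

section
/- Let E be a reflexive Banach space and let J = Ψ − Φ be a functional of class (𝒥) in E. Fix r₀ > 0, let {r_n} ⊂ (0,∞) with r_n → 0, let u_n ∈ G_{r₀ + r_n} for each n, and suppose u_n ⇀ u⋆ weakly in E with u⋆ ∈ ∂Ã_{r₀}. Then u_n → u⋆ strongly in E; moreover, for any sequence {s_n} ⊂ (0,∞) with s_n u_n ∈ ∂Ã_{r₀ + d_n r_n} for some d_n ∈ (0,1), one has s_n → 1. -/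
open Filter Topology Set

variable {E : Type*}

/-- A convex function that is nonpositive at the origin is subhomogeneous under contractions. -/
theorem ConvexOn.map_smul_le_mul_of_map_zero_nonpos [AddCommGroup E] [Module ℝ E] {f : E → ℝ}
    (hf : ConvexOn ℝ Set.univ f) (h0 : f 0 ≤ 0) {t : ℝ} (ht0 : 0 ≤ t) (ht1 : t ≤ 1) (x : E) :
    f (t • x) ≤ t * f x := by
  have h := hf.2 (Set.mem_univ x) (Set.mem_univ 0) ht0 (sub_nonneg.2 ht1) (by ring)
  simp only [smul_zero, add_zero, smul_eq_mul] at h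
  nlinarith [mul_nonpos_of_nonneg_of_nonpos (sub_nonneg.2 ht1) h0]

/-- If `u n → x`, `f x > 0` and `f (s n • u n) → f x` for a continuous convex `f` with `f 0 ≤ 0`,
then the positive scalars `s n` tend to `1`. -/
theorem ConvexOn.tendsto_one_of_tendsto_map_smul [NormedAddCommGroup E] [NormedSpace ℝ E]
    {f : E → ℝ} (hf : ConvexOn ℝ Set.univ f) (hc : Continuous f) (h0 : f 0 ≤ 0)
    {u : ℕ → E} {x : E} (hu : Tendsto u atTop (𝓝 x)) (hx : 0 < f x)
    {s : ℕ → ℝ} (hs : ∀ n, 0 < s n)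
    (hfs : Tendsto (fun n => f (s n • u n)) atTop (𝓝 (f x))) :
    Tendsto s atTop (𝓝 1) := by
  have hlim (c : ℝ) : Tendsto (fun n => f (c • u n)) atTop (𝓝 (f (c • x))) :=
    (hc.tendsto _).comp (hu.const_smul c)
  refine tendsto_order.2 ⟨fun a ha => ?_, fun b hb => ?_⟩
  · rcases le_or_gt a 0 with ha0 | ha0
    · exact Eventually.of_forall fun n => ha0.trans_lt (hs n)
    have hax : f (a • x) < f x :=
      (hf.map_smul_le_mul_of_map_zero_nonpos h0 ha0.le ha.le x).trans_lt (by nlinarith)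
    filter_upwards [(hlim a).eventually_lt hfs hax, hfs.eventually_const_lt hx]
      with n hn hpos
    by_contra! hle
    have hq1 : s n / a ≤ 1 := (div_le_one ha0).2 hle
    have hq0 : 0 < s n / a := div_pos (hs n) ha0
    have h := hf.map_smul_le_mul_of_map_zero_nonpos h0 hq0.le hq1 (a • u n)
    rw [smul_smul, div_mul_cancel₀ _ ha0.ne'] at h
    nlinarith
  · have hb0 : 0 < b := one_pos.trans hb
    have hbx : f x < f (b • x) := by
      have h := hf.map_smul_le_mul_of_map_zero_nonpos h0 (inv_pos.2 hb0).le
        (inv_le_one_of_one_le₀ hb.le) (b • x)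
      rw [inv_smul_smul₀ hb0.ne', ← div_eq_inv_mul, le_div_iff₀ hb0] at h
      nlinarith
    filter_upwards [hfs.eventually_lt (hlim b) hbx, hfs.eventually_const_lt hx]
      with n hn hpos
    by_contra! hle
    have hq1 : b / s n ≤ 1 := (div_le_one (hs n)).2 hle
    have h := hf.map_smul_le_mul_of_map_zero_nonpos h0 (div_pos hb0 (hs n)).le hq1 (s n • u n)
    rw [smul_smul, div_mul_cancel₀ _ (hs n).ne'] at h
    nlinarith

/-- Claim 2 in Proposition (provardif): if `J = Ψ - Φ` is of class (𝒥), `r₀ > 0`,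
`rₙ → 0⁺`, `uₙ ∈ G_(r₀+rₙ)`, and `uₙ ⇀ u⋆` with `u⋆ ∈ ∂Ã_(r₀)`, then `uₙ → u⋆`
strongly, and any `sₙ > 0` with `sₙ uₙ ∈ ∂Ã_(r₀+dₙrₙ)`, `dₙ ∈ (0,1)`, satisfies
`sₙ → 1`. -/
theorem strong_convergence_and_s_n_tendsto_one [NormedAddCommGroup E] [NormedSpace ℝ E] [CompleteSpace E]
    (hrefl : Function.Surjective (NormedSpace.inclusionInDoubleDual ℝ E))
    (Ψ Φ : E → ℝ) (hΨC1 : ContDiff ℝ 1 Ψ) (hΦC1 : ContDiff ℝ 1 Φ)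
    -- (Ψ1): Ψ is convex, coercive and weakly (sequentially) lower semicontinuous
    (hΨconv : ConvexOn ℝ Set.univ Ψ)
    (hΨcoer : Tendsto Ψ (Bornology.cobounded E) atTop)
    (hΨwlsc : ∀ (u : ℕ → E) (u₀ : E), WeakConv u u₀ →
      ∀ ε > (0:ℝ), ∀ᶠ n in atTop, Ψ u₀ - ε < Ψ (u n))
    -- (Ψ2): Ã₀ = {0} and 0 ∈ int Ã_r for every r > 0
    (hΨ2a : {u : E | Ψ u ≤ 0} = {0})
    (hΨ2b : ∀ r > (0:ℝ), (0:E) ∈ interior {u : E | Ψ u ≤ r})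
    -- (Ψ3): Ψ'(u)u ≠ 0 on every boundary ∂Ã_r, r > 0
    (hΨ3 : ∀ r > (0:ℝ), ∀ u : E, Ψ u = r → fderiv ℝ Ψ u u ≠ 0)
    -- (Ψ4): for every u ≠ 0 and r > 0 there is a unique t > 0 with t • u ∈ ∂Ã_r
    (hΨ4 : ∀ u : E, u ≠ 0 → ∀ r > (0:ℝ), ∃! t : ℝ, 0 < t ∧ Ψ (t • u) = r)
    -- (Ψ5): weak convergence plus convergence of Ψ-values implies strong convergence
    (hΨ5 : ∀ (u : ℕ → E) (u₀ : E), WeakConv u u₀ →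
      Tendsto (fun n => Ψ (u n)) atTop (𝓝 (Ψ u₀)) → Tendsto u atTop (𝓝 u₀))
    -- Φ is weakly (sequentially) upper semicontinuous
    (hΦwusc : ∀ (u : ℕ → E) (u₀ : E), WeakConv u u₀ →
      ∀ ε > (0:ℝ), ∀ᶠ n in atTop, Φ (u n) < Φ u₀ + ε)
    -- (Φ1), second part: u ↦ Φ'(u)u/Ψ'(u)u is weakly (sequentially) upper
    -- semicontinuous on E ∖ {0}
    (hQwusc : ∀ (u : ℕ → E) (u₀ : E), u₀ ≠ 0 → (∀ n, u n ≠ 0) → WeakConv u u₀ →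
      ∀ ε > (0:ℝ), ∀ᶠ n in atTop,
        fderiv ℝ Φ (u n) (u n) / fderiv ℝ Ψ (u n) (u n) <
          fderiv ℝ Φ u₀ u₀ / fderiv ℝ Ψ u₀ u₀ + ε)
    -- (Φ2): critical points of Φ have nonpositive Φ-value
    (hΦ2 : ∀ u : E, fderiv ℝ Φ u = 0 → Φ u ≤ 0)
    -- (Φ3): there is a sequence vₙ → 0 with Φ(vₙ) > 0
    (hΦ3 : ∃ v : ℕ → E, Tendsto v atTop (𝓝 0) ∧ ∀ n, 0 < Φ (v n))
    (r₀ : ℝ) (hr₀ : 0 < r₀)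
    (r : ℕ → ℝ) (hrpos : ∀ n, 0 < r n) (hrlim : Tendsto r atTop (𝓝 0))
    (u : ℕ → E)
    (hu : ∀ n, Ψ (u n) ≤ r₀ + r n ∧ ∀ v : E, Ψ v ≤ r₀ + r n → Φ v ≤ Φ (u n))
    (ustar : E) (hweak : WeakConv u ustar) (hbd : Ψ ustar = r₀) :
    Tendsto u atTop (𝓝 ustar) ∧
      ∀ s d : ℕ → ℝ, (∀ n, 0 < s n) → (∀ n, d n ∈ Set.Ioo (0:ℝ) 1) →
        (∀ n, Ψ (s n • u n) = r₀ + d n * r n) → Tendsto s atTop (𝓝 1) := by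
  have hupper : Tendsto (fun n => r₀ + r n) atTop (𝓝 r₀) := by
    simpa using hrlim.const_add r₀
  have hΨu : Tendsto (fun n => Ψ (u n)) atTop (𝓝 (Ψ ustar)) := by
    refine tendsto_order.2 ⟨fun a ha => ?_, fun b hb => ?_⟩
    · filter_upwards [hΨwlsc u ustar hweak (Ψ ustar - a) (sub_pos.2 ha)] with n hn
      linarith
    · filter_upwards [hupper.eventually_lt_const (hbd ▸ hb)] with n hn
      exact (hu n).1.trans_lt hn
  have hstrong := hΨ5 u ustar hweak hΨu
  refine ⟨hstrong, fun s d hs hd hsd => ?_⟩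
  have h0 : Ψ 0 ≤ 0 := by
    have h : (0 : E) ∈ {u : E | Ψ u ≤ 0} := hΨ2a ▸ Set.mem_singleton 0
    exact h
  refine hΨconv.tendsto_one_of_tendsto_map_smul hΨC1.continuous h0 hstrong (hbd ▸ hr₀) hs ?_
  rw [hbd]
  refine tendsto_of_tendsto_of_tendsto_of_le_of_le tendsto_const_nhds hupper (fun n => ?_)
    (fun n => ?_)
  · simp only [hsd]
    nlinarith [mul_pos (hd n).1 (hrpos n)]
  · simp only [hsd]
    nlinarith [mul_lt_mul_of_pos_right (hd n).2 (hrpos n)]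
end

section
/- Let E be a reflexive Banach space and let Ψ, Φ : E → ℝ be C¹ functionals with J = Ψ − Φ. Assume (Ψ1), that 0 is an interior point of Ã_r for each r > 0, that Φ is weakly (sequentially) upper semicontinuous, and (Φ2)–(Φ3). Then for every r > 0 and every u_r ∈ G_r one has ζ(r) = r − max_{u ∈ ∂Ã_r} Φ(u) = min_{u ∈ ∂Ã_r} J(u) = J(u_r); in particular the minimum of J over ∂Ã_r is attained at any maximizer of Φ over Ã_r. -/
open Filter Topology Set

variable {E : Type*}

/-- If a constrained maximizer of `Φ` over a sublevel set of a continuous `Ψ` is not critical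
for `Φ`, the constraint is active there. -/
theorem eq_of_isMaxOn_sublevel [NormedAddCommGroup E] [NormedSpace ℝ E] {Ψ Φ : E → ℝ} {r : ℝ}
    {u : E} (hΨ : ContinuousAt Ψ u) (hu : Ψ u ≤ r) (hmax : IsMaxOn Φ {v | Ψ v ≤ r} u)
    (hcrit : fderiv ℝ Φ u ≠ 0) : Ψ u = r := by
  by_contra hne
  have hlt : ∀ᶠ v in 𝓝 u, Ψ v < r := hΨ.eventually_lt_const (lt_of_le_of_ne hu hne)
  have hloc : IsLocalMax Φ u := hlt.mono fun v hv => hmax hv.le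
  exact hcrit hloc.fderiv_eq_zero

/-- The energy function identity: for every `r > 0` and every `u_r ∈ G_r`,
`ζ(r) = r - max_(∂Ã_r) Φ = min_(∂Ã_r) J = J(u_r)`. -/
theorem energy_function_identity [NormedAddCommGroup E] [NormedSpace ℝ E] [CompleteSpace E]
    (hrefl : Function.Surjective (NormedSpace.inclusionInDoubleDual ℝ E))
    (Ψ Φ : E → ℝ) (hΨC1 : ContDiff ℝ 1 Ψ) (hΦC1 : ContDiff ℝ 1 Φ)
    -- (Ψ1): Ψ is convex, coercive and weakly (sequentially) lower semicontinuous
    (hΨconv : ConvexOn ℝ Set.univ Ψ)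
    (hΨcoer : Tendsto Ψ (Bornology.cobounded E) atTop)
    (hΨwlsc : ∀ (u : ℕ → E) (u₀ : E), WeakConv u u₀ →
      ∀ ε > (0:ℝ), ∀ᶠ n in atTop, Ψ u₀ - ε < Ψ (u n))
    -- 0 ∈ int Ã_r for every r > 0
    (hΨ2b : ∀ r > (0:ℝ), (0:E) ∈ interior {u : E | Ψ u ≤ r})
    -- Φ is weakly (sequentially) upper semicontinuous
    (hΦwusc : ∀ (u : ℕ → E) (u₀ : E), WeakConv u u₀ →
      ∀ ε > (0:ℝ), ∀ᶠ n in atTop, Φ (u n) < Φ u₀ + ε)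
    -- (Φ2): critical points of Φ have nonpositive Φ-value
    (hΦ2 : ∀ u : E, fderiv ℝ Φ u = 0 → Φ u ≤ 0)
    -- (Φ3): there is a sequence vₙ → 0 with Φ(vₙ) > 0
    (hΦ3 : ∃ v : ℕ → E, Tendsto v atTop (𝓝 0) ∧ ∀ n, 0 < Φ (v n))
    -- the functional J = Ψ - Φ
    (J : E → ℝ) (hJ : ∀ u : E, J u = Ψ u - Φ u)
    :
    ∀ r > (0:ℝ), ∀ u_r : E, Ψ u_r ≤ r → (∀ v : E, Ψ v ≤ r → Φ v ≤ Φ u_r) →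
      Ψ u_r = r ∧ (∀ u : E, Ψ u = r → J u_r ≤ J u) ∧
      r - sSup (Φ '' {u : E | Ψ u = r}) = J u_r := by
  intro r hr u hu hmax
  have hpos : 0 < Φ u := by
    obtain ⟨v, hv, hvpos⟩ := hΦ3
    obtain ⟨n, hn⟩ := (hv.eventually (mem_interior_iff_mem_nhds.mp (hΨ2b r hr))).exists
    exact (hvpos n).trans_le (hmax (v n) hn)
  have hΨu : Ψ u = r := eq_of_isMaxOn_sublevel hΨC1.continuous.continuousAt hu hmax
    fun h => hpos.not_ge (hΦ2 u h)
  have hgreatest : IsGreatest (Φ '' {w : E | Ψ w = r}) (Φ u) := by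
    refine ⟨mem_image_of_mem Φ hΨu, ?_⟩
    rintro _ ⟨w, hw, rfl⟩
    exact hmax w (le_of_eq hw)
  refine ⟨hΨu, fun w hw => ?_, ?_⟩
  · rw [hJ, hJ, hΨu, hw]
    exact sub_le_sub_left (hmax w hw.le) r
  · rw [hgreatest.csSup_eq, hJ, hΨu]
end

section
/- Let E be a reflexive Banach space and let J = Ψ − Φ be a functional of class (𝒥) in E. If u belongs to the Nehari set 𝒩 = {u ∈ E∖{0} : J'(u)u = 0} and u is a maximum energy type point of G_r for some r > 0, then u is a critical point of J, i.e. J'(u) = 0. -/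
open Filter Topology Set

variable {E : Type*}

/-- Remark: if `u` lies in the Nehari set `𝒩 = {u ≠ 0 : J'(u)u = 0}` and `u` is a
maximum energy type point of `G_r` for some `r > 0`, then `u` is a critical point
of `J`. -/
theorem nehari_max_energy_is_critical [NormedAddCommGroup E] [NormedSpace ℝ E] [CompleteSpace E]
    (hrefl : Function.Surjective (NormedSpace.inclusionInDoubleDual ℝ E))
    (Ψ Φ : E → ℝ) (hΨC1 : ContDiff ℝ 1 Ψ) (hΦC1 : ContDiff ℝ 1 Φ)
    -- (Ψ1): Ψ is convex, coercive and weakly (sequentially) lower semicontinuous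
    (hΨconv : ConvexOn ℝ Set.univ Ψ)
    (hΨcoer : Tendsto Ψ (Bornology.cobounded E) atTop)
    (hΨwlsc : ∀ (u : ℕ → E) (u₀ : E), WeakConv u u₀ →
      ∀ ε > (0:ℝ), ∀ᶠ n in atTop, Ψ u₀ - ε < Ψ (u n))
    -- (Ψ2): Ã₀ = {0} and 0 ∈ int Ã_r for every r > 0
    (hΨ2a : {u : E | Ψ u ≤ 0} = {0})
    (hΨ2b : ∀ r > (0:ℝ), (0:E) ∈ interior {u : E | Ψ u ≤ r})
    -- (Ψ3): Ψ'(u)u ≠ 0 on every boundary ∂Ã_r, r > 0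
    (hΨ3 : ∀ r > (0:ℝ), ∀ u : E, Ψ u = r → fderiv ℝ Ψ u u ≠ 0)
    -- (Ψ4): for every u ≠ 0 and r > 0 there is a unique t > 0 with t • u ∈ ∂Ã_r
    (hΨ4 : ∀ u : E, u ≠ 0 → ∀ r > (0:ℝ), ∃! t : ℝ, 0 < t ∧ Ψ (t • u) = r)
    -- (Ψ5): weak convergence plus convergence of Ψ-values implies strong convergence
    (hΨ5 : ∀ (u : ℕ → E) (u₀ : E), WeakConv u u₀ →
      Tendsto (fun n => Ψ (u n)) atTop (𝓝 (Ψ u₀)) → Tendsto u atTop (𝓝 u₀))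
    -- Φ is weakly (sequentially) upper semicontinuous
    (hΦwusc : ∀ (u : ℕ → E) (u₀ : E), WeakConv u u₀ →
      ∀ ε > (0:ℝ), ∀ᶠ n in atTop, Φ (u n) < Φ u₀ + ε)
    -- (Φ1), second part: u ↦ Φ'(u)u/Ψ'(u)u is weakly (sequentially) upper
    -- semicontinuous on E ∖ {0}
    (hQwusc : ∀ (u : ℕ → E) (u₀ : E), u₀ ≠ 0 → (∀ n, u n ≠ 0) → WeakConv u u₀ →
      ∀ ε > (0:ℝ), ∀ᶠ n in atTop,
        fderiv ℝ Φ (u n) (u n) / fderiv ℝ Ψ (u n) (u n) <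
          fderiv ℝ Φ u₀ u₀ / fderiv ℝ Ψ u₀ u₀ + ε)
    -- (Φ2): critical points of Φ have nonpositive Φ-value
    (hΦ2 : ∀ u : E, fderiv ℝ Φ u = 0 → Φ u ≤ 0)
    -- (Φ3): there is a sequence vₙ → 0 with Φ(vₙ) > 0
    (hΦ3 : ∃ v : ℕ → E, Tendsto v atTop (𝓝 0) ∧ ∀ n, 0 < Φ (v n))
    -- the functional J = Ψ - Φ
    (J : E → ℝ) (hJ : ∀ u : E, J u = Ψ u - Φ u)
    (u : E) (hu0 : u ≠ 0)
    -- u belongs to the Nehari set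
    (hNehari : fderiv ℝ J u u = 0)
    (r : ℝ) (hr : 0 < r)
    -- u ∈ G_r
    (hur₁ : Ψ u ≤ r) (hur₂ : ∀ v : E, Ψ v ≤ r → Φ v ≤ Φ u)
    -- u is a maximum energy type point
    (hur₃ : ∀ v : E, Ψ v ≤ r → (∀ z : E, Ψ z ≤ r → Φ z ≤ Φ v) →
      fderiv ℝ Φ v v / fderiv ℝ Ψ v v ≤ fderiv ℝ Φ u u / fderiv ℝ Ψ u u) :
    fderiv ℝ J u = 0 := by
  have hΨd : Differentiable ℝ Ψ := hΨC1.differentiable one_ne_zero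
  have hΦd : Differentiable ℝ Φ := hΦC1.differentiable one_ne_zero
  have hΦpos : 0 < Φ u := by
    obtain ⟨v, hv, hvpos⟩ := hΦ3
    obtain ⟨n, hn⟩ := (hv.eventually (mem_interior_iff_mem_nhds.mp (hΨ2b r hr))).exists
    exact (hvpos n).trans_le (hur₂ _ hn)
  have hΨu : Ψ u = r := by
    by_contra hne
    have hmax : IsLocalMax Φ u := by
      filter_upwards [hΨd.continuous.continuousAt.eventually_lt_const (hur₁.lt_of_ne hne)]
        with v hv using hur₂ v hv.le
    exact hΦpos.not_ge (hΦ2 u hmax.fderiv_eq_zero)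
  have hJ' : fderiv ℝ J u = fderiv ℝ Ψ u - fderiv ℝ Φ u := by
    rw [show J = fun v => Ψ v - Φ v from funext hJ]
    exact fderiv_fun_sub (hΨd u) (hΦd u)
  have hextr : IsLocalExtrOn Φ {v | Ψ v = Ψ u} u :=
    Or.inr <| eventually_nhdsWithin_of_forall fun v hv => hur₂ v (le_of_eq hv |>.trans hur₁)
  obtain ⟨a, b, hab, h⟩ := hextr.exists_multipliers_of_hasStrictFDerivAt_1d
    (hΨC1.contDiffAt.hasStrictFDerivAt one_ne_zero)
    (hΦC1.contDiffAt.hasStrictFDerivAt one_ne_zero)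
  have hne := hΨ3 r hr u hΨu
  have hNu : fderiv ℝ Ψ u u = fderiv ℝ Φ u u := by
    rw [hJ'] at hNehari
    exact sub_eq_zero.mp hNehari
  have hsum : a + b = 0 := by
    have hu := DFunLike.congr_fun h u
    simp only [add_apply, smul_apply, zero_apply, smul_eq_mul, ← hNu, ← add_mul] at hu
    exact (mul_eq_zero.mp hu).resolve_right hne
  obtain rfl : a = -b := eq_neg_of_add_eq_zero_left hsum
  have hb : b ≠ 0 := by
    rintro rfl
    simp at hab
  rw [hJ', sub_eq_zero]
  ext w
  have hw := DFunLike.congr_fun h w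
  simp only [add_apply, smul_apply, zero_apply, smul_eq_mul] at hw
  exact mul_left_cancel₀ hb (by linarith)
end
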